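/- Consider the sequences produced by Algorithm AGM-EF-1 (as specified in the context), and set L' := L/σ + λ2. Then for every k ≥ 1 and every x ∈ dom Ψ, J(x_k) − J(x) ≤ (L/σ − λ1) Δ(x, u₀) · min{ (1 − √(λ/L'))^k, 4/(2 + k)² }. -/

import Mathlib

noncomputable section

open scoped BigOperators

/-- Bregman divergence induced by `d`. -/
def breg {E : Type*} [NormedAddCommGroup E] [NormedSpace ℝ E]
    (d : E → ℝ) (x y : E) : ℝ :=
  d x - d y - fderiv ℝ d y (x - y)

/-- `d` is `σ`-strongly convex with respect to the norm `‖·‖`. -/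
def StrongConvexOnNorm {E : Type*} [NormedAddCommGroup E] [NormedSpace ℝ E]
    (σ : ℝ) (d : E → ℝ) : Prop :=
  ∀ x y : E, d x ≥ d y + fderiv ℝ d y (x - y) + σ / 2 * ‖x - y‖ ^ 2

/-- `g` is a subgradient of the extended-real-valued function `h` at `y`. -/
def IsSubgradE {E : Type*} [NormedAddCommGroup E] [NormedSpace ℝ E]
    (h : E → EReal) (y : E) (g : E →L[ℝ] ℝ) : Prop :=
  ∀ x, h x ≥ h y + ((g (x - y) : ℝ) : EReal)

/-- `h` is `lam`-strongly convex with respect to `d` (extended-real-valued version). -/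
def ScWrtE {E : Type*} [NormedAddCommGroup E] [NormedSpace ℝ E]
    (d : E → ℝ) (lam : ℝ) (h : E → EReal) : Prop :=
  ∀ y : E, h y ≠ ⊤ → ∀ g : E →L[ℝ] ℝ, IsSubgradE h y g →
    ∀ x, h x ≥ h y + ((g (x - y) + lam * breg d x y : ℝ) : EReal)

/-- `f` is `lam`-strongly convex with respect to `d` (real-valued version). -/
def ScWrtR {E : Type*} [NormedAddCommGroup E] [NormedSpace ℝ E]
    (d : E → ℝ) (lam : ℝ) (f : E → ℝ) : Prop :=
  ∀ y : E, ∀ g : E →L[ℝ] ℝ, (∀ x, f x ≥ f y + g (x - y)) →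
    ∀ x, f x ≥ f y + g (x - y) + lam * breg d x y

/-- Convexity for extended-real-valued functions. -/
def ConvexE {E : Type*} [NormedAddCommGroup E] [NormedSpace ℝ E]
    (h : E → EReal) : Prop :=
  ∀ x y : E, ∀ a b : ℝ, 0 ≤ a → 0 ≤ b → a + b = 1 →
    h (a • x + b • y) ≤ ((a : ℝ) : EReal) * h x + ((b : ℝ) : EReal) * h y

/-- The lower model `ℓ_f(x; y, lam1)`. -/
def ellf {E : Type*} [NormedAddCommGroup E] [NormedSpace ℝ E]
    (d : E → ℝ) (f : E → ℝ) (lam1 : ℝ) (x y : E) : ℝ :=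
  f y + fderiv ℝ f y (x - y) + lam1 * breg d x y


section EstimateSequence

open Set Filter Topology

/-- First-order optimality for the sum of a differentiable and a convex function. -/
theorem ConvexOn.sub_fderiv_le_of_forall_add_le {E : Type*} [NormedAddCommGroup E]
    [NormedSpace ℝ E] {D : Set E} {p φ : E → ℝ} {φ' : E →L[ℝ] ℝ} {y w : E}
    (hp : ConvexOn ℝ D p) (hφ : HasFDerivAt φ φ' y) (hy : y ∈ D) (hw : w ∈ D)
    (hmin : ∀ v ∈ D, φ y + p y ≤ φ v + p v) : p y - φ' (w - y) ≤ p w := by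
  have hline : HasDerivAt (fun t : ℝ => y + t • (w - y)) (w - y) 0 := by
    simpa using ((hasDerivAt_id (0 : ℝ)).smul_const (w - y)).const_add y
  have hφ0 : HasFDerivAt φ φ' (y + (0 : ℝ) • (w - y)) := by simpa using hφ
  have hg := (hφ0.comp_hasDerivAt (0 : ℝ) hline).add
    ((hasDerivAt_id (0 : ℝ)).mul_const (p w - p y))
  have hlim := hg.tendsto_slope_zero_right
  have hnn : 0 ≤ φ' (w - y) + 1 * (p w - p y) := by
    refine ge_of_tendsto hlim ?_
    filter_upwards [Ioo_mem_nhdsGT (zero_lt_one' ℝ)] with t ht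
    have hcomb : y + t • (w - y) = (1 - t) • y + t • w := by module
    have hmem : y + t • (w - y) ∈ D := by
      rw [hcomb]
      exact hp.1 hy hw (by linarith [ht.2]) ht.1.le (by ring)
    have hconv := hp.2 hy hw (by linarith [ht.2] : (0 : ℝ) ≤ 1 - t) ht.1.le (by ring)
    rw [← hcomb] at hconv
    simp only [smul_eq_mul] at hconv
    have := hmin _ hmem
    have h0 : (0 : ℝ) < t⁻¹ := inv_pos.2 ht.1
    simp only [Pi.add_apply, Function.comp_apply, zero_add, zero_smul, add_zero, zero_mul, id,
      smul_eq_mul]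
    apply mul_nonneg h0.le
    nlinarith
  linarith

/-- The gradient inequality for a differentiable convex function. -/
theorem ConvexOn.add_fderiv_le {E : Type*} [NormedAddCommGroup E] [NormedSpace ℝ E]
    {f : E → ℝ} (hf : ConvexOn ℝ univ f) (hd : Differentiable ℝ f) (y w : E) :
    f y + fderiv ℝ f y (w - y) ≤ f w := by
  have := hf.sub_fderiv_le_of_forall_add_le (w := w) (hd y).hasFDerivAt.neg (mem_univ y)
    (mem_univ w) (by intro v _; simp)
  simp only [neg_apply] at this
  linarith

/-- The descent lemma: quadratic upper bound for a function with Lipschitz derivative. -/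
theorem le_add_fderiv_add_sq_of_lipschitz {E : Type*} [NormedAddCommGroup E] [NormedSpace ℝ E]
    {f : E → ℝ} {L : ℝ} (hd : Differentiable ℝ f)
    (hL : ∀ x y : E, ‖fderiv ℝ f x - fderiv ℝ f y‖ ≤ L * ‖x - y‖) (y w : E) :
    f w ≤ f y + fderiv ℝ f y (w - y) + L / 2 * ‖w - y‖ ^ 2 := by
  set v := w - y with hv
  have hline (t : ℝ) : HasDerivAt (fun t : ℝ => y + t • v) v t := by
    simpa using ((hasDerivAt_id t).smul_const v).const_add y
  have hg (t : ℝ) : HasDerivAt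
      (fun t : ℝ => f (y + t • v) - t * fderiv ℝ f y v - t ^ 2 * (L / 2 * ‖v‖ ^ 2))
      (fderiv ℝ f (y + t • v) v - fderiv ℝ f y v - 2 * t * (L / 2 * ‖v‖ ^ 2)) t := by
    have h1 := (hd (y + t • v)).hasFDerivAt.comp_hasDerivAt t (hline t)
    have h2 := (hasDerivAt_id t).mul_const (fderiv ℝ f y v)
    have h3 := (hasDerivAt_pow 2 t).mul_const (L / 2 * ‖v‖ ^ 2)
    exact ((h1.sub h2).sub h3).congr_deriv (by simp)
  have hanti := antitoneOn_of_deriv_nonpos (convex_Icc (0 : ℝ) 1)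
    (fun t _ => (hg t).continuousAt.continuousWithinAt)
    (fun t _ => (hg t).differentiableAt.differentiableWithinAt) (by
      intro t ht
      rw [interior_Icc] at ht
      rw [(hg t).deriv]
      have h1 := (fderiv ℝ f (y + t • v) - fderiv ℝ f y).le_opNorm v
      have h2 := hL (y + t • v) y
      rw [add_sub_cancel_left, norm_smul, Real.norm_of_nonneg ht.1.le] at h2
      have h3 := (le_abs_self _).trans h1
      have h4 := mul_le_mul_of_nonneg_right h2 (norm_nonneg v)
      rw [sub_apply] at h3
      nlinarith)
  have h := hanti (left_mem_Icc.2 zero_le_one) (right_mem_Icc.2 zero_le_one) zero_le_one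
  have hw : y + v = w := by rw [hv]; abel
  simp only [one_smul, hw, zero_smul, add_zero] at h
  linarith

theorem half_mul_sq_le_breg {E : Type*} [NormedAddCommGroup E] [NormedSpace ℝ E] {σ : ℝ}
    {d : E → ℝ} (hd : StrongConvexOnNorm σ d) (x y : E) : σ / 2 * ‖x - y‖ ^ 2 ≤ breg d x y := by
  have := hd x y
  unfold breg
  linarith

theorem breg_nonneg {E : Type*} [NormedAddCommGroup E] [NormedSpace ℝ E] {σ : ℝ} (hσ : 0 < σ)
    {d : E → ℝ} (hd : StrongConvexOnNorm σ d) (x y : E) : 0 ≤ breg d x y :=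
  le_trans (by positivity) (half_mul_sq_le_breg hd x y)

/-- A minimizer of an affine function plus `κ • d + β • p`, with `p` strongly convex with respect
to `d`, satisfies the quadratic growth inequality measured by the Bregman divergence. -/
theorem add_breg_le_of_forall_le {E : Type*} [NormedAddCommGroup E] [NormedSpace ℝ E]
    {D : Set E} {p d : E → ℝ} {lam κ β b : ℝ} {l : E →L[ℝ] ℝ} {y w : E}
    (hd : Differentiable ℝ d) (hp : ConvexOn ℝ D p)
    (hsc : ∀ y ∈ D, ∀ g : E →L[ℝ] ℝ, (∀ x ∈ D, p y + g (x - y) ≤ p x) →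
      ∀ x ∈ D, p y + g (x - y) + lam * breg d x y ≤ p x)
    (hβ : 0 < β) (hy : y ∈ D) (hw : w ∈ D)
    (hmin : ∀ v ∈ D, l y + b + κ * d y + β * p y ≤ l v + b + κ * d v + β * p v) :
    l y + b + κ * d y + β * p y + (κ + β * lam) * breg d w y ≤
      l w + b + κ * d w + β * p w := by
  have hφ : HasFDerivAt (fun v => β⁻¹ * (l v + b + κ * d v))
      (β⁻¹ • (l + κ • fderiv ℝ d y)) y := by
    have := ((l.hasFDerivAt (x := y)).add_const b).add ((hd y).hasFDerivAt.const_mul κ)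
    exact this.const_mul β⁻¹
  have hmin' : ∀ v ∈ D, β⁻¹ * (l y + b + κ * d y) + p y ≤ β⁻¹ * (l v + b + κ * d v) + p v := by
    intro v hv
    have h := mul_le_mul_of_nonneg_left (hmin v hv) (inv_pos.2 hβ).le
    have e (s t : ℝ) : β⁻¹ * (s + β * t) = β⁻¹ * s + t := by field_simp
    rwa [e, e] at h
  have hsub := hsc y hy (-(β⁻¹ • (l + κ • fderiv ℝ d y))) (by
    intro x hx
    have := hp.sub_fderiv_le_of_forall_add_le hφ hy hx hmin'
    simpa [sub_eq_add_neg] using this) w hw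
  have h := mul_le_mul_of_nonneg_left hsub hβ.le
  simp only [neg_apply, smul_apply,
    add_apply, smul_eq_mul, map_sub] at h
  unfold breg at h ⊢
  simp only [map_sub] at h ⊢
  have hinv : β * β⁻¹ = 1 := mul_inv_cancel₀ hβ.ne'
  linear_combination h + (l w - l y + κ * (fderiv ℝ d y w - fderiv ℝ d y y)) * hinv

/-- Points of the domain of a closed convex function with an affine minorant are approximated by
points admitting a subgradient pointing towards them (Bregman proximal points). -/
theorem exists_subgradient_near {E : Type*} [NormedAddCommGroup E] [NormedSpace ℝ E]
    [FiniteDimensional ℝ E] {D : Set E} {p d : E → ℝ} {σ ε : ℝ} {m y₀ : E} {g₀ : E →L[ℝ] ℝ}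
    (hσ : 0 < σ) (hd : Differentiable ℝ d) (hdsc : StrongConvexOnNorm σ d)
    (hp : ConvexOn ℝ D p) (hepi : IsClosed {v : E × ℝ | v.1 ∈ D ∧ p v.1 ≤ v.2})
    (hg₀ : ∀ x ∈ D, p y₀ + g₀ (x - y₀) ≤ p x) (hm : m ∈ D) (hε : 0 < ε) :
    ∃ y ∈ D, ∃ g : E →L[ℝ] ℝ, ‖y - m‖ ≤ ε ∧ (∀ x ∈ D, p y + g (x - y) ≤ p x) ∧
      0 ≤ g (m - y) := by
  set G := ‖g₀‖ with hG
  set A := p m - p y₀ - g₀ (m - y₀) with hA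
  have hG0 : 0 ≤ G := norm_nonneg _
  have hA0 : 0 ≤ A := by have := hg₀ m hm; linarith
  have hlow : ∀ x ∈ D, p m - A - G * ‖x - m‖ ≤ p x := by
    intro x hx
    have h1 := hg₀ x hx
    have h2 := (neg_abs_le _).trans' (neg_le_neg (g₀.le_opNorm (x - m)))
    have h3 : g₀ (x - y₀) = g₀ (x - m) + g₀ (m - y₀) := by rw [← map_add]; congr 1; abel
    linarith
  set N := G + (A + G + 1) / ε ^ 2 with hN
  have hN0 : 0 < N := by positivity
  set n := 2 * N / σ with hn
  have hn0 : 0 < n := by positivity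
  have hnear : ∀ v : E × ℝ, v.1 ∈ D → p v.1 ≤ v.2 → v.2 + n * breg d v.1 m ≤ p m →
      ‖v.1 - m‖ ≤ ε := by
    intro v hv hpv hle
    have h1 := hlow v.1 hv
    have h2 := mul_le_mul_of_nonneg_left (half_mul_sq_le_breg hdsc v.1 m) hn0.le
    have h3 : n * (σ / 2 * ‖v.1 - m‖ ^ 2) = N * ‖v.1 - m‖ ^ 2 := by rw [hn]; field_simp
    set r := ‖v.1 - m‖
    have h4 : (A + G + 1) / ε ^ 2 * r ^ 2 ≤ A + G + 1 := by
      have h5 : N * r ^ 2 ≤ A + G * r := by linarith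
      have h6 : G * r ≤ G * (1 + r ^ 2) :=
        mul_le_mul_of_nonneg_left (by nlinarith [sq_nonneg (r - 1)]) hG0
      rw [hN] at h5
      linarith
    have h7 : r ^ 2 ≤ ε ^ 2 := by
      rw [div_mul_eq_mul_div, div_le_iff₀ (by positivity)] at h4
      exact le_of_mul_le_mul_left h4 (by positivity)
    exact le_of_sq_le_sq h7 hε.le
  have hcont : Continuous (fun v : E × ℝ => v.2 + n * breg d v.1 m) := by
    have hdc := hd.continuous
    unfold breg
    fun_prop
  set K := {v : E × ℝ | v.1 ∈ D ∧ p v.1 ≤ v.2} ∩ {v | v.2 + n * breg d v.1 m ≤ p m} with hK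
  have hKclosed : IsClosed K := hepi.inter (isClosed_le hcont continuous_const)
  have hKsub : K ⊆ Metric.closedBall m ε ×ˢ Icc (p m - A - G * ε) (p m) := by
    rintro v ⟨⟨hv, hpv⟩, hle⟩
    have h1 := hnear v hv hpv hle
    have h2 := mul_nonneg hn0.le (breg_nonneg hσ hdsc v.1 m)
    have h3 := hlow v.1 hv
    have h4 := mul_le_mul_of_nonneg_left h1 hG0
    simp only [mem_ofPred_eq] at hle
    exact ⟨by simpa [dist_eq_norm] using h1, by linarith, by linarith⟩
  have hKcompact : IsCompact K :=
    ((isCompact_closedBall m ε).prod isCompact_Icc).of_isClosed_subset hKclosed hKsub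
  have hmK : (m, p m) ∈ K := ⟨⟨hm, le_rfl⟩, by simp [breg]⟩
  obtain ⟨v, hvK, hvmin⟩ := hKcompact.exists_isMinOn ⟨_, hmK⟩ hcont.continuousOn
  have hvmin' : ∀ x ∈ D, n * breg d v.1 m + p v.1 ≤ n * breg d x m + p x := by
    intro x hx
    have h0 := hvK.1.2
    by_cases hxK : p x + n * breg d x m ≤ p m
    · have h : v.2 + n * breg d v.1 m ≤ p x + n * breg d x m :=
        hvmin (show (x, p x) ∈ K from ⟨⟨hx, le_rfl⟩, hxK⟩)
      linarith
    · have h : v.2 + n * breg d v.1 m ≤ p m := hvK.2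
      linarith
  have hφ : HasFDerivAt (fun x => n * breg d x m)
      (n • (fderiv ℝ d v.1 - fderiv ℝ d m)) v.1 := by
    have h1 : HasFDerivAt (fun x => fderiv ℝ d m (x - m)) (fderiv ℝ d m) v.1 :=
      (fderiv ℝ d m).hasFDerivAt.comp v.1 (hasFDerivAt_sub_const m)
    exact (((hd v.1).hasFDerivAt.sub_const (d m)).sub h1).const_mul n
  refine ⟨v.1, hvK.1.1, -(n • (fderiv ℝ d v.1 - fderiv ℝ d m)),
    hnear v hvK.1.1 hvK.1.2 hvK.2, ?_, ?_⟩
  · intro x hx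
    have := hp.sub_fderiv_le_of_forall_add_le hφ hvK.1.1 hx hvmin'
    simpa [sub_eq_add_neg] using this
  · have h1 := breg_nonneg hσ hdsc v.1 m
    have h2 := breg_nonneg hσ hdsc m v.1
    have h3 : -(n • (fderiv ℝ d v.1 - fderiv ℝ d m)) (m - v.1) =
        n * (breg d v.1 m + breg d m v.1) := by
      simp only [breg, smul_apply,
        sub_apply, smul_eq_mul, map_sub]
      ring
    rw [neg_apply, h3]
    positivity

/-- Strong convexity with respect to `d`, formulated by subgradients, implies the strong convexity
inequality along segments of the domain. -/
theorem add_sq_le_of_strongConvex_subgradient {E : Type*} [NormedAddCommGroup E]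
    [NormedSpace ℝ E] [FiniteDimensional ℝ E] {D : Set E} {p d : E → ℝ} {σ lam a : ℝ}
    {x z y₀ : E} {g₀ : E →L[ℝ] ℝ} (hσ : 0 < σ) (hlam : 0 ≤ lam) (hd : Differentiable ℝ d)
    (hdsc : StrongConvexOnNorm σ d) (hp : ConvexOn ℝ D p)
    (hepi : IsClosed {v : E × ℝ | v.1 ∈ D ∧ p v.1 ≤ v.2})
    (hsc : ∀ y ∈ D, ∀ g : E →L[ℝ] ℝ, (∀ x ∈ D, p y + g (x - y) ≤ p x) →
      ∀ x ∈ D, p y + g (x - y) + lam * breg d x y ≤ p x)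
    (hg₀ : ∀ x ∈ D, p y₀ + g₀ (x - y₀) ≤ p x) (hx : x ∈ D) (hz : z ∈ D)
    (ha : a ∈ Ioo (0 : ℝ) 1) :
    p ((1 - a) • x + a • z) + lam * (σ / 2) * (a * (1 - a)) * ‖z - x‖ ^ 2 ≤
      (1 - a) * p x + a * p z := by
  set m := (1 - a) • x + a • z with hm
  have ha1 : 0 ≤ 1 - a := by linarith [ha.2]
  have hmD : m ∈ D := hp.1 hx hz ha1 ha.1.le (by ring)
  have key : ∀ n : ℕ, ∃ y ∈ D, ‖y - m‖ ≤ 1 / ((n : ℝ) + 1) ∧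
      p y ≤ (1 - a) * p x + a * p z -
        lam * (σ / 2) * ((1 - a) * ‖x - y‖ ^ 2 + a * ‖z - y‖ ^ 2) := by
    intro n
    obtain ⟨y, hy, g, hyε, hg, hgm⟩ := exists_subgradient_near hσ hd hdsc hp hepi hg₀ hmD
      (Nat.one_div_pos_of_nat (α := ℝ) (n := n))
    refine ⟨y, hy, hyε, ?_⟩
    have h1 := hsc y hy g hg x hx
    have h2 := hsc y hy g hg z hz
    have h3 := mul_le_mul_of_nonneg_left (half_mul_sq_le_breg hdsc x y) hlam
    have h4 := mul_le_mul_of_nonneg_left (half_mul_sq_le_breg hdsc z y) hlam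
    have h5 : g (m - y) = (1 - a) * g (x - y) + a * g (z - y) := by
      rw [hm]; simp only [map_sub, map_add, map_smul, smul_eq_mul]; ring
    have h6 := mul_le_mul_of_nonneg_left (h1.trans' (add_le_add_right h3 _)) ha1
    have h7 := mul_le_mul_of_nonneg_left (h2.trans' (add_le_add_right h4 _)) ha.1.le
    linarith
  choose y hyD hyε hpy using key
  have hylim : Tendsto y atTop (𝓝 m) := by
    rw [tendsto_iff_norm_sub_tendsto_zero]
    exact squeeze_zero (fun _ => norm_nonneg _) hyε tendsto_one_div_add_atTop_nhds_zero_nat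
  have hcont : Continuous (fun y : E => (y, (1 - a) * p x + a * p z -
      lam * (σ / 2) * ((1 - a) * ‖x - y‖ ^ 2 + a * ‖z - y‖ ^ 2))) := by fun_prop
  have hmem := hepi.mem_of_tendsto ((hcont.tendsto m).comp hylim)
    (Eventually.of_forall fun n => ⟨hyD n, hpy n⟩)
  have hle := hmem.2
  simp only at hle
  have e1 : x - m = (-a) • (z - x) := by rw [hm]; module
  have e2 : z - m = (1 - a) • (z - x) := by rw [hm]; module
  rw [e1, e2, norm_smul, norm_smul, norm_neg, Real.norm_of_nonneg ha.1.le,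
    Real.norm_of_nonneg ha1] at hle
  linear_combination hle

theorem norm_weighted_sum_sq_le {E : Type*} [NormedAddCommGroup E] [NormedSpace ℝ E]
    {t₁ t₂ t₃ : ℝ} (h₁ : 0 ≤ t₁) (h₂ : 0 ≤ t₂) (h₃ : 0 ≤ t₃) (v₁ v₂ v₃ : E) :
    ‖t₁ • v₁ + t₂ • v₂ + t₃ • v₃‖ ^ 2 ≤
      (t₁ + t₂ + t₃) * (t₁ * ‖v₁‖ ^ 2 + t₂ * ‖v₂‖ ^ 2 + t₃ * ‖v₃‖ ^ 2) := by
  have h := norm_add₃_le (a := t₁ • v₁) (b := t₂ • v₂) (c := t₃ • v₃)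
  rw [norm_smul, norm_smul, norm_smul, Real.norm_of_nonneg h₁, Real.norm_of_nonneg h₂,
    Real.norm_of_nonneg h₃] at h
  refine (pow_le_pow_left₀ (norm_nonneg _) h 2).trans ?_
  have e₁ := mul_nonneg (mul_nonneg h₁ h₂) (sq_nonneg (‖v₁‖ - ‖v₂‖))
  have e₂ := mul_nonneg (mul_nonneg h₁ h₃) (sq_nonneg (‖v₁‖ - ‖v₃‖))
  have e₃ := mul_nonneg (mul_nonneg h₂ h₃) (sq_nonneg (‖v₂‖ - ‖v₃‖))
  linear_combination e₁ + e₂ + e₃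

/-- The interpolation point `u` of the accelerated method makes the quadratic error of the descent
lemma at the new iterate absorbable by the three strong convexity terms. -/
theorem extrapolation_sq_le {E : Type*} [NormedAddCommGroup E] [NormedSpace ℝ E]
    {σ L lam₁ lam₂ a c : ℝ} {x z u w : E} (hlam₁ : 0 ≤ lam₁)
    (hlam₂ : 0 ≤ lam₂) (hc : 0 < c) (ha : a ∈ Ioo (0 : ℝ) 1)
    (hL : 0 ≤ L)
    (hroot : σ * (1 - a) * (c + lam₂ * a) + σ * lam₁ * a = L * a ^ 2)
    (hu : u = ((((1 - a) * c + lam₁ * a + lam₂ * a * (1 - a)) - lam₁ * a * a)⁻¹) •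
          (((((1 - a) * c + lam₁ * a + lam₂ * a * (1 - a))
                - ((1 - a) * c + lam₁ * a) * a) • x)
            + (((1 - a) * c * a) • z))) :
    L * ‖(1 - a) • x + a • w - u‖ ^ 2 ≤ σ * ((1 - a) * c * ‖w - z‖ ^ 2 +
      lam₁ * a * ‖w - u‖ ^ 2 + lam₂ * a * (1 - a) * ‖w - x‖ ^ 2) := by
  have ha0 := ha.1
  have ha1 : 0 < 1 - a := by linarith [ha.2]
  set t₁ := (1 - a) * c with ht₁
  set t₂ := lam₁ * a with ht₂
  set t₃ := lam₂ * a * (1 - a) with ht₃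
  have h₁ : 0 < t₁ := by positivity
  have h₂ : 0 ≤ t₂ := by positivity
  have h₃ : 0 ≤ t₃ := by positivity
  set t := t₁ + t₂ + t₃ with ht
  have htpos : 0 < t := by positivity
  have hne : t - t₂ * a ≠ 0 := by
    have : 0 ≤ t₂ * (1 - a) := by positivity
    nlinarith
  have hu' : (t - t₂ * a) • u = (t - (t₁ + t₂) * a) • x + (t₁ * a) • z := by
    rw [hu, smul_inv_smul₀ hne]
  have hvec : t • ((1 - a) • x + a • w - u) =
      a • (t₁ • (w - z) + t₂ • (w - u) + t₃ • (w - x)) := by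
    have hz0 : t • ((1 - a) • x + a • w - u) -
      a • (t₁ • (w - z) + t₂ • (w - u) + t₃ • (w - x)) =
      ((t - (t₁ + t₂) * a) • x + (t₁ * a) • z) - (t - t₂ * a) • u := by
      rw [ht]; module
    rw [hu', sub_self] at hz0
    exact sub_eq_zero.1 hz0
  have hnorm := congrArg (fun v => ‖v‖ ^ 2) hvec
  simp only [norm_smul, Real.norm_of_nonneg ha0.le, Real.norm_of_nonneg htpos.le, mul_pow]
    at hnorm
  have hcs := norm_weighted_sum_sq_le h₁.le h₂ h₃ (w - z) (w - u) (w - x)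
  have hst : σ * t = L * a ^ 2 := by rw [← hroot, ht, ht₁, ht₂, ht₃]; ring
  set S := t₁ * ‖w - z‖ ^ 2 + t₂ * ‖w - u‖ ^ 2 + t₃ * ‖w - x‖ ^ 2
  have h := mul_le_mul_of_nonneg_left hcs (show 0 ≤ L * a ^ 2 by positivity)
  refine le_of_mul_le_mul_left (a := t ^ 2) ?_ (by positivity)
  calc t ^ 2 * (L * ‖(1 - a) • x + a • w - u‖ ^ 2)
      = L * (t ^ 2 * ‖(1 - a) • x + a • w - u‖ ^ 2) := by ring
    _ ≤ L * a ^ 2 * (t * S) := by rw [hnorm]; linarith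
    _ = t ^ 2 * (σ * S) := by rw [← hst]; ring

/-- One step of the estimate-sequence argument. -/
theorem objective_le_estimate_step {E : Type*} [NormedAddCommGroup E] [NormedSpace ℝ E]
    {p d f : E → ℝ} {σ L lam₁ lam₂ a c v : ℝ} {x z u w : E} (hσ : 0 < σ) (hlam₁ : 0 ≤ lam₁)
    (hlam₂ : 0 ≤ lam₂) (hc : 0 < c) (ha : a ∈ Ioo (0 : ℝ) 1) (hL : 0 ≤ L)
    (hroot : σ * (1 - a) * (c + lam₂ * a) + σ * lam₁ * a = L * a ^ 2)
    (hu : u = ((((1 - a) * c + lam₁ * a + lam₂ * a * (1 - a)) - lam₁ * a * a)⁻¹) •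
          (((((1 - a) * c + lam₁ * a + lam₂ * a * (1 - a))
                - ((1 - a) * c + lam₁ * a) * a) • x)
            + (((1 - a) * c * a) • z)))
    (hdsc : StrongConvexOnNorm σ d) (hfd : Differentiable ℝ f)
    (hfL : ∀ x y : E, ‖fderiv ℝ f x - fderiv ℝ f y‖ ≤ L * ‖x - y‖)
    (hfx : ellf d f lam₁ x u ≤ f x) (hv : f x + p x ≤ v)
    (hp : p ((1 - a) • x + a • w) + lam₂ * (σ / 2) * (a * (1 - a)) * ‖w - x‖ ^ 2 ≤
      (1 - a) * p x + a * p w) :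
    f ((1 - a) • x + a • w) + p ((1 - a) • x + a • w) ≤
      (1 - a) * (v + c * breg d w z) + a * (ellf d f lam₁ w u + p w) := by
  have ha0 := ha.1
  have ha1 : 0 < 1 - a := by linarith [ha.2]
  have h1 := extrapolation_sq_le (w := w) hlam₁ hlam₂ hc ha hL hroot hu
  have h2 := le_add_fderiv_add_sq_of_lipschitz hfd hfL u ((1 - a) • x + a • w)
  have h3 := mul_le_mul_of_nonneg_left (half_mul_sq_le_breg hdsc w z)
    (show 0 ≤ (1 - a) * c by positivity)
  have h4 := mul_le_mul_of_nonneg_left (half_mul_sq_le_breg hdsc w u)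
    (show 0 ≤ lam₁ * a by positivity)
  have h5 := mul_nonneg (show 0 ≤ (1 - a) * lam₁ by positivity) (breg_nonneg hσ hdsc x u)
  have h6 := mul_le_mul_of_nonneg_left hv ha1.le
  have h7 := mul_le_mul_of_nonneg_left hfx ha1.le
  have h8 : fderiv ℝ f u ((1 - a) • x + a • w - u) =
      (1 - a) * fderiv ℝ f u (x - u) + a * fderiv ℝ f u (w - u) := by
    simp only [map_sub, map_add, map_smul, smul_eq_mul]; ring
  unfold ellf at *
  rw [h8] at h2
  linear_combination h1 / 2 + h2 + h3 + h4 + h5 + h6 + h7 + hp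

/-- Rate of decay of the product of the factors `1 - a (i + 1)`. -/
theorem prod_one_sub_le_min {M lam : ℝ} {a c : ℕ → ℝ} (hlam : 0 ≤ lam) (hM : 0 < M)
    (hlamM : lam ≤ M) (hc0 : c 0 = M) (ha : ∀ k, a (k + 1) ∈ Ioo (0 : ℝ) 1)
    (hc : ∀ k, c (k + 1) = (1 - a (k + 1)) * c k + lam * a (k + 1))
    (hroot : ∀ k, M * a (k + 1) ^ 2 = c (k + 1)) (k : ℕ) :
    ∏ i ∈ Finset.range k, (1 - a (i + 1)) ≤
      min ((1 - √(lam / M)) ^ k) (4 / (2 + (k : ℝ)) ^ 2) := by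
  set P : ℕ → ℝ := fun k => ∏ i ∈ Finset.range k, (1 - a (i + 1)) with hP
  have hPs (k : ℕ) : P (k + 1) = P k * (1 - a (k + 1)) := Finset.prod_range_succ _ _
  have hPpos (k : ℕ) : 0 < P k := Finset.prod_pos fun i _ => by linarith [(ha i).2]
  have hPle (k : ℕ) : P k ≤ 1 :=
    Finset.prod_le_one (fun i _ => by linarith [(ha i).2]) fun i _ => by linarith [(ha i).1]
  have hcP (k : ℕ) : c k = lam + P k * (M - lam) := by
    induction k with
    | zero => simp [hP, hc0]
    | succ k ih => rw [hc, hPs, ih]; ring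
  have hal (k : ℕ) : √(lam / M) ≤ a (k + 1) := by
    refine Real.sqrt_le_iff.2 ⟨(ha k).1.le, ?_⟩
    rw [div_le_iff₀ hM]
    have := mul_nonneg (hPpos (k + 1)).le (sub_nonneg.2 hlamM)
    linarith [hroot k, hcP (k + 1)]
  have haP (k : ℕ) : √(P (k + 1)) ≤ a (k + 1) := by
    refine Real.sqrt_le_iff.2 ⟨(ha k).1.le, ?_⟩
    refine le_of_mul_le_mul_left (a := M) ?_ hM
    have := mul_nonneg hlam (sub_nonneg.2 (hPle (k + 1)))
    linarith [hroot k, hcP (k + 1)]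
  have hsqrt (k : ℕ) : √(P k) ≤ 2 / (2 + (k : ℝ)) := by
    induction k with
    | zero => simp [hP]
    | succ k ih =>
      have hs : 0 < √(P (k + 1)) := Real.sqrt_pos.2 (hPpos _)
      have h1 : √(P (k + 1)) ^ 2 ≤ √(P k) ^ 2 * (1 - √(P (k + 1))) := by
        rw [Real.sq_sqrt (hPpos _).le, Real.sq_sqrt (hPpos _).le]
        exact (hPs k).le.trans
          (mul_le_mul_of_nonneg_left (by linarith [haP k]) (hPpos k).le)
      have hs1 : √(P (k + 1)) < 1 := (haP k).trans_lt (ha k).2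
      have hr := pow_le_pow_left₀ (Real.sqrt_nonneg _) ih 2
      set s := √(P (k + 1))
      have h2 : s ^ 2 ≤ (2 / (2 + (k : ℝ))) ^ 2 * (1 - s) :=
        h1.trans (mul_le_mul_of_nonneg_right hr (by linarith))
      have hk : (0 : ℝ) ≤ k := k.cast_nonneg
      push_cast
      by_contra! hlt
      rw [div_lt_iff₀ (by positivity)] at hlt
      rw [div_pow, div_mul_eq_mul_div, le_div_iff₀ (by positivity)] at h2
      have h3 : s * (2 + (k : ℝ)) ≤ 2 - s := by
        refine le_of_sq_le_sq ?_ (by linarith)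
        nlinarith [sq_nonneg s]
      linarith
  refine le_min ?_ ?_
  · induction k with
    | zero => simp
    | succ k ih =>
      rw [pow_succ]
      refine (hPs k).le.trans (mul_le_mul ih (by linarith [hal k]) (by linarith [(ha k).2]) ?_)
      exact (hPpos k).le.trans ih
  · have h := pow_le_pow_left₀ (Real.sqrt_nonneg _) (hsqrt k) 2
    rw [Real.sq_sqrt (hPpos k).le, div_pow] at h
    norm_num at h
    exact h

theorem convexOn_toReal {E : Type*} [NormedAddCommGroup E] [NormedSpace ℝ E] {Ψ : E → EReal}
    (hbot : ∀ x, Ψ x ≠ ⊥) (hconv : ConvexE Ψ) :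
    ConvexOn ℝ {w | Ψ w ≠ ⊤} fun w => (Ψ w).toReal := by
  have key : ∀ x, Ψ x ≠ ⊤ → ∀ y, Ψ y ≠ ⊤ → ∀ a b : ℝ, 0 ≤ a → 0 ≤ b → a + b = 1 →
      Ψ (a • x + b • y) ≤ ((a * (Ψ x).toReal + b * (Ψ y).toReal : ℝ) : EReal) := by
    intro x hx y hy a b ha hb hab
    have h := hconv x y a b ha hb hab
    rw [← EReal.coe_toReal hx (hbot x), ← EReal.coe_toReal hy (hbot y)] at h
    exact_mod_cast h
  have hdom : Convex ℝ {w | Ψ w ≠ ⊤} := fun x hx y hy a b ha hb hab =>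
    ((key x hx y hy a b ha hb hab).trans_lt (EReal.coe_lt_top _)).ne
  refine ⟨hdom, fun x hx y hy a b ha hb hab => ?_⟩
  have h := key x hx y hy a b ha hb hab
  rw [← EReal.coe_toReal (hdom hx hy ha hb hab) (hbot _)] at h
  exact_mod_cast h

theorem isClosed_epigraph_toReal {E : Type*} [NormedAddCommGroup E] {Ψ : E → EReal}
    (hbot : ∀ x, Ψ x ≠ ⊥) (hlsc : LowerSemicontinuous Ψ) :
    IsClosed {v : E × ℝ | v.1 ∈ {w | Ψ w ≠ ⊤} ∧ (Ψ v.1).toReal ≤ v.2} := by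
  have h : IsClosed {v : E × ℝ | Ψ v.1 ≤ (v.2 : EReal)} :=
    hlsc.isClosed_epigraph.preimage
      (continuous_fst.prodMk (continuous_coe_real_ereal.comp continuous_snd))
  convert h using 1
  ext v
  constructor
  · rintro ⟨h1, h2⟩
    change Ψ v.1 ≤ (v.2 : EReal)
    rw [← EReal.coe_toReal h1 (hbot _)]
    exact_mod_cast h2
  · intro hv
    have hv' : Ψ v.1 ≤ (v.2 : EReal) := hv
    have h1 : Ψ v.1 ≠ ⊤ := (hv'.trans_lt (EReal.coe_lt_top _)).ne
    refine ⟨h1, ?_⟩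
    rw [← EReal.coe_toReal h1 (hbot _)] at hv'
    exact_mod_cast hv'

theorem ScWrtE.toReal {E : Type*} [NormedAddCommGroup E] [NormedSpace ℝ E] {Ψ : E → EReal}
    {d : E → ℝ} {lam : ℝ} (hbot : ∀ x, Ψ x ≠ ⊥) (hsc : ScWrtE d lam Ψ) :
    ∀ y ∈ {w | Ψ w ≠ ⊤}, ∀ g : E →L[ℝ] ℝ,
      (∀ x ∈ {w | Ψ w ≠ ⊤}, (Ψ y).toReal + g (x - y) ≤ (Ψ x).toReal) →
      ∀ x ∈ {w | Ψ w ≠ ⊤}, (Ψ y).toReal + g (x - y) + lam * breg d x y ≤ (Ψ x).toReal := by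
  intro y hy g hg x hx
  have h := hsc y hy g (by
    intro w
    by_cases hw : Ψ w = ⊤
    · rw [hw]; exact le_top
    · have := hg w hw
      rw [← EReal.coe_toReal hw (hbot w), ← EReal.coe_toReal hy (hbot y)]
      exact_mod_cast this) x
  rw [← EReal.coe_toReal hx (hbot x), ← EReal.coe_toReal hy (hbot y)] at h
  rw [add_assoc]
  exact_mod_cast h

end EstimateSequence

/-- rate of convergence of AGM-EF-1. -/
theorem stmt15 {E : Type*} [NormedAddCommGroup E] [NormedSpace ℝ E] [FiniteDimensional ℝ E]
    (σ lam1 lam2 L : ℝ) (hσ : 0 < σ) (hlam1 : 0 ≤ lam1) (hlam2 : 0 ≤ lam2)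
    (hL : σ * lam1 < L)
    (d : E → ℝ) (hddiff : Differentiable ℝ d) (hdconv : ConvexOn ℝ Set.univ d)
    (hdsc : StrongConvexOnNorm σ d)
    (Ψ : E → EReal) (hΨbot : ∀ x, Ψ x ≠ ⊥) (hΨprop : ∃ x, Ψ x ≠ ⊤)
    (hΨlsc : LowerSemicontinuous Ψ) (hΨconv : ConvexE Ψ) (hΨsc : ScWrtE d lam2 Ψ)
    (f : E → ℝ) (hfconv : ConvexOn ℝ Set.univ f) (hfdiff : Differentiable ℝ f)
    (hfsc : ScWrtR d lam1 f)
    (hfL : ∀ x y : E, ‖fderiv ℝ f x - fderiv ℝ f y‖ ≤ L * ‖x - y‖)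
    -- Algorithm AGM-EF-1
    (x z u : ℕ → E) (a c : ℕ → ℝ) (ψ q : ℕ → E → EReal)
    (hu0 : Ψ (u 0) ≠ ⊤) (hc0 : c 0 = L / σ + lam2)
    (hq0 : ∀ w, q 0 w =
      ((L / σ * breg d w (u 0) + f (u 0) + fderiv ℝ f (u 0) (w - u 0) : ℝ) : EReal) + Ψ w)
    (hx0 : x 0 = z 0) (hz0min : ∀ w, q 0 (z 0) ≤ q 0 w)
    (hamem : ∀ k, a (k + 1) ∈ Set.Ioo (0 : ℝ) 1)
    (haroot : ∀ k, σ * (1 - a (k + 1)) * (c k + lam2 * a (k + 1)) + σ * lam1 * a (k + 1)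
        = L * a (k + 1) ^ 2)
    (hc : ∀ k, c (k + 1) = (1 - a (k + 1)) * c k + (lam1 + lam2) * a (k + 1))
    (hu : ∀ k,
      u (k + 1) =
        ((((1 - a (k + 1)) * c k + lam1 * a (k + 1) + lam2 * a (k + 1) * (1 - a (k + 1)))
            - lam1 * a (k + 1) * a (k + 1))⁻¹) •
          (((((1 - a (k + 1)) * c k + lam1 * a (k + 1) + lam2 * a (k + 1) * (1 - a (k + 1)))
                - ((1 - a (k + 1)) * c k + lam1 * a (k + 1)) * a (k + 1)) • x k)
            + (((1 - a (k + 1)) * c k * a (k + 1)) • z k)))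
    (hψ : ∀ k w, ψ (k + 1) w =
      ((1 - a (k + 1) : ℝ) : EReal) * q k w
        + ((a (k + 1) : ℝ) : EReal) * (((ellf d f lam1 w (u (k + 1)) : ℝ) : EReal) + Ψ w))
    (hz : ∀ k w, ψ (k + 1) (z (k + 1)) ≤ ψ (k + 1) w)
    (hx : ∀ k, x (k + 1) = (1 - a (k + 1)) • x k + a (k + 1) • z (k + 1))
    (hq : ∀ k w, q (k + 1) w =
      ((c (k + 1) * breg d w (z (k + 1)) : ℝ) : EReal) + ψ (k + 1) (z (k + 1)))
    :
    ∀ k : ℕ, 1 ≤ k → ∀ w : E, Ψ w ≠ ⊤ →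
      (((f (x k) : ℝ) : EReal) + Ψ (x k)) - (((f w : ℝ) : EReal) + Ψ w) ≤
        (((L / σ - lam1) * breg d w (u 0) *
            min ((1 - Real.sqrt ((lam1 + lam2) / (L / σ + lam2))) ^ k)
              (4 / (2 + (k : ℝ)) ^ 2) : ℝ) : EReal) := by
 
  set D : Set E := {w | Ψ w ≠ ⊤} with hD
  set p : E → ℝ := fun w => (Ψ w).toReal with hpdef
  have hpΨ : ∀ w ∈ D, Ψ w = (p w : EReal) := fun w hw => (EReal.coe_toReal hw (hΨbot w)).symm
  have hp : ConvexOn ℝ D p := convexOn_toReal hΨbot hΨconv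
  have hepi : IsClosed {v : E × ℝ | v.1 ∈ D ∧ p v.1 ≤ v.2} :=
    isClosed_epigraph_toReal hΨbot hΨlsc
  have hsc : ∀ y ∈ D, ∀ g : E →L[ℝ] ℝ, (∀ x ∈ D, p y + g (x - y) ≤ p x) →
      ∀ x ∈ D, p y + g (x - y) + lam2 * breg d x y ≤ p x := ScWrtE.toReal hΨbot hΨsc
  have hLσ : lam1 < L / σ := by rw [lt_div_iff₀ hσ]; linarith
  have hL0 : 0 ≤ L := (by positivity : 0 ≤ σ * lam1).trans hL.le
  have hell : ∀ w y, ellf d f lam1 w y ≤ f w := fun w y =>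
    hfsc y (fderiv ℝ f y) (fun x => hfconv.add_fderiv_le hfdiff y x) w
  have hcpos : ∀ k, 0 < c k := by
    intro k
    induction k with
    | zero => rw [hc0]; linarith
    | succ k ih =>
      have h1 := mul_pos (sub_pos.2 (hamem k).2) ih
      have h2 := mul_nonneg (add_nonneg hlam1 hlam2) (hamem k).1.le
      rw [hc]
      linarith
  -- the initial model
  set l₀ : E →L[ℝ] ℝ := fderiv ℝ f (u 0) - (L / σ) • fderiv ℝ d (u 0) with hl₀
  set b₀ : ℝ := f (u 0) - fderiv ℝ f (u 0) (u 0) +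
    L / σ * (fderiv ℝ d (u 0) (u 0) - d (u 0)) with hb₀
  have hmodel₀ : ∀ w, L / σ * breg d w (u 0) + f (u 0) + fderiv ℝ f (u 0) (w - u 0) =
      l₀ w + b₀ + L / σ * d w := by
    intro w
    simp only [breg, hl₀, hb₀, sub_apply, smul_apply, smul_eq_mul, map_sub]
    ring
  have hq0D : ∀ w ∈ D, q 0 w = ((l₀ w + b₀ + L / σ * d w + 1 * p w : ℝ) : EReal) := by
    intro w hw
    rw [hq0, hmodel₀, hpΨ w hw, one_mul]
    exact (EReal.coe_add _ _).symm
  have hz0D : z 0 ∈ D := by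
    intro htop
    have h := hz0min (u 0)
    rw [hq0D _ hu0, hq0, htop, EReal.coe_add_top] at h
    exact absurd h (not_le.2 (EReal.coe_lt_top _))
  have hmin₀ : ∀ w ∈ D, l₀ (z 0) + b₀ + L / σ * d (z 0) + 1 * p (z 0) ≤
      l₀ w + b₀ + L / σ * d w + 1 * p w := by
    intro w hw
    have h := hz0min w
    rw [hq0D _ hz0D, hq0D _ hw] at h
    exact_mod_cast h
  obtain ⟨g₀, hg₀⟩ : ∃ g₀ : E →L[ℝ] ℝ, ∀ w ∈ D, p (z 0) + g₀ (w - z 0) ≤ p w := by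
    refine ⟨-(l₀ + (L / σ) • fderiv ℝ d (z 0)), fun w hw => ?_⟩
    have hφ : HasFDerivAt (fun v => l₀ v + b₀ + L / σ * d v)
        (l₀ + (L / σ) • fderiv ℝ d (z 0)) (z 0) :=
      (l₀.hasFDerivAt.add_const b₀).add ((hddiff (z 0)).hasFDerivAt.const_mul (L / σ))
    have h := hp.sub_fderiv_le_of_forall_add_le hφ hz0D hw (by simpa using hmin₀)
    rw [neg_apply]
    linarith
  have inv : ∀ k, x k ∈ D ∧ z k ∈ D ∧ (∀ w, q k w ≠ ⊥) ∧
      ∃ (l : E →L[ℝ] ℝ) (b κ β v : ℝ), 0 ≤ β ∧ c k = κ + β * lam2 ∧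
        (∀ w ∈ D, q k w = ((l w + b + κ * d w + β * p w : ℝ) : EReal)) ∧
        f (x k) + p (x k) ≤ v ∧
        (∀ w ∈ D, v + c k * breg d w (z k) ≤ l w + b + κ * d w + β * p w) ∧
        (∀ w ∈ D, l w + b + κ * d w + β * p w - (f w + p w) ≤
          (∏ i ∈ Finset.range k, (1 - a (i + 1))) * ((L / σ - lam1) * breg d w (u 0))) := by
    intro k
    induction k with
    | zero =>
      refine ⟨hx0 ▸ hz0D, hz0D, fun w => ?_, l₀, b₀, L / σ, 1,
        l₀ (z 0) + b₀ + L / σ * d (z 0) + 1 * p (z 0), zero_le_one, by rw [hc0, one_mul], hq0D, ?_, fun w hw => ?_, fun w hw => ?_⟩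
      · rw [hq0]
        exact fun h => (EReal.add_eq_bot_iff.1 h).elim (EReal.coe_ne_bot _) (hΨbot w)
      · have h1 := le_add_fderiv_add_sq_of_lipschitz hfdiff hfL (u 0) (z 0)
        have h2 := mul_le_mul_of_nonneg_left (half_mul_sq_le_breg hdsc (z 0) (u 0))
          (hlam1.trans hLσ.le)
        have h3 : L / σ * (σ / 2 * ‖z 0 - u 0‖ ^ 2) = L / 2 * ‖z 0 - u 0‖ ^ 2 := by field_simp
        rw [hx0, ← hmodel₀]
        linarith
      · have h := add_breg_le_of_forall_le hddiff hp hsc one_pos hz0D hw hmin₀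
        rwa [one_mul lam2, ← hc0] at h
      · have h := hell w (u 0)
        unfold ellf at h
        rw [← hmodel₀, Finset.prod_range_zero]
        linarith
    | succ k ih =>
      obtain ⟨hxD, hzD, hqbot, l, b, κ, β, v, hβ, hck, hqD, hJv, hgrow, hgap⟩ := ih
      have hA0 := (hamem k).1
      have hA1 : 0 < 1 - a (k + 1) := sub_pos.2 (hamem k).2
      set A := a (k + 1) with hA
      set y := u (k + 1) with hy
      set l' : E →L[ℝ] ℝ := (1 - A) • l + A • (fderiv ℝ f y - lam1 • fderiv ℝ d y) with hl'
      set b' : ℝ := (1 - A) * b +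
        A * (f y - fderiv ℝ f y y + lam1 * (fderiv ℝ d y y - d y)) with hb'
      set κ' : ℝ := (1 - A) * κ + A * lam1 with hκ'
      set β' : ℝ := (1 - A) * β + A with hβ'
      have hβ'pos : 0 < β' := by positivity
      have hmodel : ∀ w, (1 - A) * (l w + b + κ * d w + β * p w) +
          A * (ellf d f lam1 w y + p w) = l' w + b' + κ' * d w + β' * p w := by
        intro w
        simp only [ellf, breg, hl', hb', hκ', hβ', add_apply, sub_apply, smul_apply, smul_eq_mul,
          map_sub]
        ring
      have hψD : ∀ w ∈ D, ψ (k + 1) w =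
          ((l' w + b' + κ' * d w + β' * p w : ℝ) : EReal) := by
        intro w hw
        rw [hψ, hqD w hw, hpΨ w hw, ← hmodel]
        push_cast
        rfl
      have hz'D : z (k + 1) ∈ D := by
        intro htop
        have h := hz k (z 0)
        rw [hψD _ hz0D, hψ, htop, EReal.coe_add_top, EReal.coe_mul_top_of_pos hA0,
          EReal.add_top_of_ne_bot] at h
        · exact absurd h (not_le.2 (EReal.coe_lt_top _))
        · intro hbot
          rcases EReal.mul_eq_bot _ _ |>.1 hbot with h | h | h | h
          · exact EReal.coe_ne_bot _ h.1
          · exact hqbot _ h.2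
          · exact EReal.coe_ne_top _ h.1
          · exact absurd (EReal.coe_neg'.1 h.1) (not_lt.2 hA1.le)
      have hmin : ∀ w ∈ D, l' (z (k + 1)) + b' + κ' * d (z (k + 1)) + β' * p (z (k + 1)) ≤
          l' w + b' + κ' * d w + β' * p w := by
        intro w hw
        have h := hz k w
        rw [hψD _ hz'D, hψD _ hw] at h
        exact_mod_cast h
      have hgrow' : ∀ w ∈ D, _ := fun w hw =>
        add_breg_le_of_forall_le hddiff hp hsc hβ'pos hz'D hw hmin
      have hck' : c (k + 1) = κ' + β' * lam2 := by
        rw [hc, hck, hκ', hβ']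
        ring
      rw [← hck'] at hgrow'
      set V := l' (z (k + 1)) + b' + κ' * d (z (k + 1)) + β' * p (z (k + 1)) with hV
      have hx'D : x (k + 1) ∈ D := by
        rw [hx]
        exact hp.1 hxD hz'D hA1.le hA0.le (by ring)
      have hq' : ∀ w, q (k + 1) w = ((c (k + 1) * breg d w (z (k + 1)) + V : ℝ) : EReal) := by
        intro w
        rw [hq, hψD _ hz'D]
        exact (EReal.coe_add _ _).symm
      have hform : ∀ w, c (k + 1) * breg d w (z (k + 1)) + V =
          (-(c (k + 1) • fderiv ℝ d (z (k + 1)))) w +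
            (c (k + 1) * (fderiv ℝ d (z (k + 1)) (z (k + 1)) - d (z (k + 1))) + V) +
            c (k + 1) * d w + 0 * p w := by
        intro w
        simp only [breg, neg_apply, smul_apply, smul_eq_mul, map_sub]
        ring
      refine ⟨hx'D, hz'D, fun w => ?_, _, _, c (k + 1), 0, V, le_rfl, by ring,
        fun w _ => (hq' w).trans (congrArg _ (hform w)), ?_, fun w _ => ?_, fun w hw => ?_⟩
      · rw [hq']
        exact EReal.coe_ne_bot _
      · have hstep := objective_le_estimate_step hσ hlam1 hlam2 (hcpos k) (hamem k) hL0
          (haroot k) (hu k) hdsc hfdiff hfL (hell (x k) (u (k + 1))) hJv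
          (add_sq_le_of_strongConvex_subgradient hσ hlam2 hddiff hdsc hp hepi hsc hg₀ hxD hz'D
            (hamem k))
        have h := mul_le_mul_of_nonneg_left (hgrow _ hz'D) hA1.le
        rw [hx, hV, ← hmodel]
        linarith
      · rw [← hform]
        linarith
      · rw [← hform, Finset.prod_range_succ]
        have h1 := hgrow' w hw
        rw [← hmodel w] at h1
        have h2 := mul_le_mul_of_nonneg_left (hell w y) hA0.le
        have h3 := mul_le_mul_of_nonneg_left (hgap w hw) hA1.le
        linarith
  intro k _ w hw
  obtain ⟨hxD, -, -, l, b, κ, β, v, -, -, -, hJv, hgrow, hgap⟩ := inv k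
  have hprod := prod_one_sub_le_min (M := L / σ + lam2) (add_nonneg hlam1 hlam2) (by linarith)
    (by linarith) hc0 hamem hc (fun k => by
      rw [hc]
      have h := haroot k
      field_simp
      linear_combination -h) k
  have hΔ := mul_nonneg (sub_nonneg.2 hLσ.le) (breg_nonneg hσ hdsc w (u 0))
  have h1 := mul_le_mul_of_nonneg_right hprod hΔ
  have h2 := mul_nonneg (hcpos k).le (breg_nonneg hσ hdsc w (z k))
  have h3 := hgrow w hw
  have h4 := hgap w hw
  rw [hpΨ _ hxD, hpΨ w hw]
  have hfinal : f (x k) + p (x k) - (f w + p w) ≤ (L / σ - lam1) * breg d w (u 0) *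
      min ((1 - Real.sqrt ((lam1 + lam2) / (L / σ + lam2))) ^ k)
        (4 / (2 + (k : ℝ)) ^ 2) := by
    linarith
  exact_mod_cast hfinal
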